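/- Let N' be a free ℤ-module of finite rank and let N ⊆ N' be a saturated submodule, i.e. the quotient N'/N is torsion-free. Then for any v ∈ N' with v ∉ N there exist a positive integer k and an element w ∈ N' with k·w − v ∈ N, such that N ∩ ℤw = 0 and the submodule N + ℤw is saturated in N'; moreover N + ℤw is the saturation of N + ℤv in N'. (This is the reduction step in the proof of the subbundle class theorem: after rescaling a generic vector v by a rational number and translating by an element of N, one may assume that N ⊕ ℤv is a saturated sublattice of N'.) -/

import Mathlib

/-- A nonzero vector of a finite free `ℤ`-module is a positive multiple of a vector on which
some linear functional takes the value `1`. -/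
theorem exists_nsmul_eq_and_dual_apply_eq_one {Q : Type*} [AddCommGroup Q] [Module.Free ℤ Q]
    [Module.Finite ℤ Q] {q : Q} (hq : q ≠ 0) :
    ∃ (k : ℕ) (u : Q) (f : Module.Dual ℤ Q), 0 < k ∧ (k : ℤ) • u = q ∧ f u = 1 := by
  let b := Module.Free.chooseBasis ℤ Q
  let I : Ideal ℤ := LinearMap.range (Module.Dual.eval ℤ Q q)
  obtain ⟨g, hg⟩ := (IsPrincipalIdealRing.principal I).principal
  have hmem (a : ℤ) : (∃ f : Module.Dual ℤ Q, f q = a) ↔ (g.natAbs : ℤ) ∣ a := by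
    rw [Int.natAbs_dvd, ← Ideal.mem_span_singleton, ← Ideal.submodule_span_eq, ← hg]
    rfl
  choose c hc using fun i => (hmem (b.coord i q)).1 ⟨_, rfl⟩
  obtain ⟨f, hf⟩ := (hmem g.natAbs).2 dvd_rfl
  have hu : (g.natAbs : ℤ) • ∑ i, c i • b i = q := by
    conv_rhs => rw [← b.sum_repr q]
    rw [Finset.smul_sum]
    refine Finset.sum_congr rfl fun i _ => ?_
    rw [smul_smul, ← hc i, b.coord_apply]
  have hg0 : g.natAbs ≠ 0 := by
    intro h
    rw [h, Nat.cast_zero, zero_smul] at hu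
    exact hq hu.symm
  refine ⟨g.natAbs, _, f, Nat.pos_of_ne_zero hg0, hu, ?_⟩
  rw [← hu, map_smul, smul_eq_mul] at hf
  exact (mul_eq_left₀ (Nat.cast_ne_zero.2 hg0)).1 hf

/-- If `φ` vanishes on `N` and `φ w = 1`, then `x ↦ x - φ x • w` is a projection along `w`
that detects membership in `N ⊔ span {w}`. -/
theorem Submodule.mem_sup_span_singleton_iff_sub_smul_mem {R M : Type*} [CommRing R]
    [AddCommGroup M] [Module R M] {N : Submodule R M} {φ : Module.Dual R M} {w : M}
    (hφ : ∀ x ∈ N, φ x = 0) (hw : φ w = 1) {x : M} :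
    x ∈ N ⊔ Submodule.span R {w} ↔ x - φ x • w ∈ N := by
  constructor
  · intro hx
    obtain ⟨n, hn, y, hy, rfl⟩ := Submodule.mem_sup.1 hx
    obtain ⟨a, rfl⟩ := Submodule.mem_span_singleton.1 hy
    simpa [hφ n hn, hw] using hn
  · intro hx
    exact Submodule.mem_sup.2
      ⟨_, hx, _, Submodule.smul_mem _ _ (Submodule.mem_span_singleton_self w), sub_add_cancel _ _⟩

/-- **Rescaling a vector into a saturated rank-one extension.**
Let `N'` be a free `ℤ`-module of finite rank and `N ⊆ N'` a saturated
submodule (i.e. whenever `m • x ∈ N` for a nonzero integer `m`, then `x ∈ N`;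
equivalently `N'/N` is torsion-free). Then for any `v ∈ N'` with `v ∉ N`
there exist a positive integer `k` and an element `w ∈ N'` with
`k • w - v ∈ N`, such that `N ∩ ℤw = 0` and `N + ℤw` is saturated in `N'`;
moreover `N + ℤw` is the saturation of `N + ℤv` in `N'`, i.e. it consists
exactly of the `x ∈ N'` with `m • x ∈ N + ℤv` for some nonzero integer `m`. -/
theorem exists_saturated_rank_one_extension
    {N' : Type*} [AddCommGroup N'] [Module.Free ℤ N'] [Module.Finite ℤ N']
    (N : Submodule ℤ N')
    (hsat : ∀ (m : ℤ) (x : N'), m ≠ 0 → m • x ∈ N → x ∈ N)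
    (v : N') (hv : v ∉ N) :
    ∃ (k : ℕ) (w : N'), 0 < k ∧ (k : ℤ) • w - v ∈ N ∧
      N ⊓ Submodule.span ℤ {w} = ⊥ ∧
      (∀ (m : ℤ) (x : N'), m ≠ 0 → m • x ∈ N ⊔ Submodule.span ℤ {w} →
        x ∈ N ⊔ Submodule.span ℤ {w}) ∧
      (∀ x : N', x ∈ N ⊔ Submodule.span ℤ {w} ↔
        ∃ m : ℤ, m ≠ 0 ∧ m • x ∈ N ⊔ Submodule.span ℤ {v}) := by
  have : Module.IsTorsionFree ℤ (N' ⧸ N) := by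
    refine .of_smul_eq_zero fun m q h => ?_
    induction q using Submodule.Quotient.induction_on with | _ x => ?_
    rw [← Submodule.Quotient.mk_smul, Submodule.Quotient.mk_eq_zero] at h
    rw [Submodule.Quotient.mk_eq_zero]
    exact or_iff_not_imp_left.2 fun hm => hsat m x hm h
  obtain ⟨k, u, f, hk, hku, hfu⟩ := exists_nsmul_eq_and_dual_apply_eq_one
    (mt (Submodule.Quotient.mk_eq_zero N).1 hv)
  obtain ⟨w, rfl⟩ := N.mkQ_surjective u
  let φ : Module.Dual ℤ N' := f ∘ₗ N.mkQ
  have hφ : ∀ x ∈ N, φ x = 0 := fun x hx => by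
    simp [φ, (Submodule.Quotient.mk_eq_zero N).2 hx]
  have hw : φ w = 1 := hfu
  have hkw : (k : ℤ) • w - v ∈ N := (Submodule.Quotient.eq N).1 hku
  have hsat' (m : ℤ) (x : N') (hm : m ≠ 0) (hx : m • x ∈ N ⊔ Submodule.span ℤ {w}) :
      x ∈ N ⊔ Submodule.span ℤ {w} := by
    rw [Submodule.mem_sup_span_singleton_iff_sub_smul_mem hφ hw] at hx ⊢
    rw [map_smul, smul_assoc, ← smul_sub] at hx
    exact hsat m _ hm hx
  refine ⟨k, w, hk, hkw, ?_, hsat', fun x => ⟨fun hx => ?_, ?_⟩⟩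
  · refine (Submodule.eq_bot_iff _).2 fun x hx => ?_
    obtain ⟨a, rfl⟩ := Submodule.mem_span_singleton.1 hx.2
    have ha := hφ _ hx.1
    rw [map_smul, hw, smul_eq_mul, mul_one] at ha
    rw [ha, zero_smul]
  · have hkw' : (k : ℤ) • w ∈ N ⊔ Submodule.span ℤ {v} := by
      simpa using add_mem (Submodule.mem_sup_left hkw)
        (Submodule.mem_sup_right (Submodule.mem_span_singleton_self v))
    obtain ⟨n, hn, y, hy, rfl⟩ := Submodule.mem_sup.1 hx
    obtain ⟨a, rfl⟩ := Submodule.mem_span_singleton.1 hy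
    refine ⟨k, by exact_mod_cast hk.ne', ?_⟩
    rw [smul_add, smul_comm (k : ℤ) a w]
    exact add_mem (Submodule.mem_sup_left (N.smul_mem _ hn)) (Submodule.smul_mem _ a hkw')
  · rintro ⟨m, hm, hx⟩
    have hv' : v ∈ N ⊔ Submodule.span ℤ {w} := by
      simpa using sub_mem (Submodule.mem_sup_right (S := N)
        (Submodule.smul_mem _ (k : ℤ) (Submodule.mem_span_singleton_self w)))
        (Submodule.mem_sup_left hkw)
    have hle : N ⊔ Submodule.span ℤ {v} ≤ N ⊔ Submodule.span ℤ {w} :=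
      sup_le le_sup_left ((Submodule.span_singleton_le_iff_mem _ _).2 hv')
    exact hsat' m x hm (hle hx)
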